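/- For every x > 0, W[φ̃₁^I(·;−13/2), φ̃₂^II(·;−13/2)](x) = −(x² − 14)(x² − 6)³. -/

import Mathlib

/-- The degree-`v` generalized Laguerre polynomial `L_v^{(α)}(y)` for `v ∈ {1,2,3}`. -/
noncomputable def Lv (v : ℕ) (α y : ℝ) : ℝ :=
  if v = 1 then α + 1 - y
  else if v = 2 then ((α+1)*(α+2) - 2*(α+2)*y + y^2)/2
  else ((α+1)*(α+2)*(α+3) - 3*(α+2)*(α+3)*y + 3*(α+3)*y^2 - y^3)/6

/-- Type I seed function `φ̃_v^I(x;g) = e^{x²/2} x^g L_v^{(g-1/2)}(-x²)`. -/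
noncomputable def seedI (v : ℕ) (g x : ℝ) : ℝ :=
  Real.exp (x^2/2) * x ^ g * Lv v (g - 1/2) (-x^2)

/-- Type II seed function `φ̃_v^II(x;g) = e^{-x²/2} x^{1-g} L_v^{(1/2-g)}(x²)`. -/
noncomputable def seedII (v : ℕ) (g x : ℝ) : ℝ :=
  Real.exp (-x^2/2) * x ^ (1-g) * Lv v (1/2 - g) (x^2)

/-- Type III seed function `φ̃_v^III(x;g) = e^{x²/2} x^{1-g} L_v^{(1/2-g)}(-x²)`. -/
noncomputable def seedIII (v : ℕ) (g x : ℝ) : ℝ :=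
  Real.exp (x^2/2) * x ^ (1-g) * Lv v (1/2 - g) (-x^2)

/-- The Wronskian `W[f,g](x) = f(x)g'(x) - f'(x)g(x)`. -/
noncomputable def Wr (f g : ℝ → ℝ) (x : ℝ) : ℝ :=
  f x * deriv g x - deriv f x * g x

/-- The derivative of `e^{c x²/2} x^a p(x)` on the positive half-line. -/
theorem hasDerivAt_exp_mul_rpow_mul {x : ℝ} (hx : 0 < x) (c a : ℝ) {p : ℝ → ℝ} {p' : ℝ}
    (hp : HasDerivAt p p' x) :
    HasDerivAt (fun t => Real.exp (c * t ^ 2 / 2) * t ^ a * p t)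
      (Real.exp (c * x ^ 2 / 2) * x ^ a * ((c * x + a / x) * p x + p')) x := by
  have hE : HasDerivAt (fun t : ℝ => Real.exp (c * t ^ 2 / 2))
      (Real.exp (c * x ^ 2 / 2) * (c * x)) x := by
    refine HasDerivAt.exp ?_
    refine (((hasDerivAt_pow 2 x).const_mul c).div_const 2).congr_deriv ?_
    push_cast
    ring
  refine ((hE.mul (Real.hasDerivAt_rpow_const (p := a) (Or.inl hx.ne'))).mul hp).congr_deriv ?_
  simp only [Pi.mul_apply]
  rw [Real.rpow_sub_one hx.ne']
  ring

theorem seedI_one_eq : seedI 1 (-13/2) =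
    fun t => Real.exp (1 * t ^ 2 / 2) * t ^ (-13/2 : ℝ) * (t ^ 2 - 6) := by
  funext t
  simp only [seedI, Lv, if_true, one_mul]
  ring

theorem seedII_two_eq : seedII 2 (-13/2) =
    fun t => Real.exp (-1 * t ^ 2 / 2) * t ^ (15/2 : ℝ) *
      ((t ^ 2 - 6) * (t ^ 2 - 12) / 2) := by
  funext t
  have h : (1 - -13/2 : ℝ) = 15/2 := by norm_num
  simp only [seedII, Lv, h, OfNat.ofNat_ne_one, if_false, if_true, neg_one_mul]
  ring

/-- at `g = −13/2`, `W[φ̃₁^I, φ̃₂^II](x) = −(x²−14)(x²−6)³`. -/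
theorem wronskian_F_cubic_zero (x : ℝ) (hx : 0 < x) :
    Wr (seedI 1 (-13/2)) (seedII 2 (-13/2)) x = -((x^2 - 14) * (x^2 - 6)^3) := by
  have hsq : HasDerivAt (fun t : ℝ => t ^ 2) (2 * x) x := by
    simpa using hasDerivAt_pow 2 x
  have hf := hasDerivAt_exp_mul_rpow_mul hx 1 (-13/2) (hsq.sub_const 6)
  have hg := hasDerivAt_exp_mul_rpow_mul hx (-1) (15/2)
    (((hsq.sub_const 6).mul (hsq.sub_const 12)).div_const 2)
  have hexp : Real.exp (1 * x ^ 2 / 2) * Real.exp (-1 * x ^ 2 / 2) = 1 := by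
    rw [← Real.exp_add, ← Real.exp_zero]
    ring_nf
  have hpow : x ^ (-13/2 : ℝ) * x ^ (15/2 : ℝ) = x := by
    rw [← Real.rpow_add hx]
    norm_num
  have hprod : Real.exp (1 * x ^ 2 / 2) * x ^ (-13/2 : ℝ) *
      (Real.exp (-1 * x ^ 2 / 2) * x ^ (15/2 : ℝ)) = x := by
    rw [mul_mul_mul_comm, hexp, hpow, one_mul]
  have hdg : deriv (seedII 2 (-13/2)) x = _ := seedII_two_eq ▸ hg.deriv
  have hdf : deriv (seedI 1 (-13/2)) x = _ := seedI_one_eq ▸ hf.deriv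
  rw [Wr, hdf, hdg, seedI_one_eq, seedII_two_eq]
  simp only [Pi.mul_apply]
  generalize Real.exp (1 * x ^ 2 / 2) * x ^ (-13/2 : ℝ) = A at *
  generalize Real.exp (-1 * x ^ 2 / 2) * x ^ (15/2 : ℝ) = B at *
  have hx0 := hx.ne'
  field_simp
  linear_combination
    (-4 * (x ^ 2 - 14) * (x ^ 2 - 6) ^ 3) * hprod
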